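/- There exists a constant C > 0 such that for every integer n ≥ 2 the following holds. Set K = ⌈(log n)^8⌉ and let x_1, ..., x_n be i.i.d. uniform on [0,1]. Then with probability at least 1 − C/n^{10}: for every integer ℓ with 0 ≤ ℓ ≤ ⌊log n / log K⌋, every j ∈ {1,...,K^ℓ} defining the segment S = [(j−1)/K^ℓ, j/K^ℓ], and every integer i with K^ℓ·(log n)^4 ≤ i ≤ n, the number of indices t ∈ {n−i+1,...,n} with x_t ∈ S lies in the range i/K^ℓ ± (1/20)·d(i/K^ℓ). -/

import Mathlib

open MeasureTheory
open scoped Classical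

/-- The distribution of `n` i.i.d. uniform samples from `[0,1]`. -/
noncomputable def uniformCube (n : ℕ) : Measure (Fin n → ℝ) :=
  Measure.pi fun _ => (volume : Measure ℝ).restrict (Set.Icc 0 1)

/-- `dFn y = y - ⌈y - (1/2)·y^(2/3)⌉`, so that `⌈y - (1/2)·y^(2/3)⌉ = y - dFn y`. -/
noncomputable def dFn (y : ℝ) : ℝ := y - (⌈y - (1/2) * y ^ ((2:ℝ)/3)⌉ : ℤ)

/-- The parameter `K = ⌈(log n)^8⌉`. -/
noncomputable def Kparam (n : ℕ) : ℕ := ⌈(Real.log n) ^ 8⌉₊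

/-- The set of indices among the last `i` of `{0,…,n-1}` whose item lies in `[a,b]`. -/
noncomputable def lastHits {n : ℕ} (x : Fin n → ℝ) (i : ℕ) (a b : ℝ) : Finset (Fin n) :=
  Finset.univ.filter fun t : Fin n => n - i ≤ (t : ℕ) ∧ x t ∈ Set.Icc a b

theorem integral_exp_indicator_sub_le {Ω : Type*} [MeasurableSpace Ω] (μ : Measure Ω)
    [IsProbabilityMeasure μ] {S : Set Ω} (hS : MeasurableSet S) {s : ℝ} (hs : |s| ≤ 1) :
    ∫ u, Real.exp (s * (S.indicator 1 u - μ.real S)) ∂μ ≤ Real.exp (μ.real S * s ^ 2) := by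
  set p := μ.real S
  have hp : 0 ≤ p := measureReal_nonneg
  have h_eq : ∀ u, Real.exp (s * (S.indicator 1 u - p)) =
      Real.exp (-(s * p)) * (1 + S.indicator (fun _ => Real.exp s - 1) u) := by
    intro u
    by_cases hu : u ∈ S
    · simp only [hu, Set.indicator_of_mem, Pi.one_apply, add_sub_cancel, ← Real.exp_add]
      congr 1
      ring
    · simp [hu]
  have h_int : ∫ u, (1 + S.indicator (fun _ => Real.exp s - 1) u) ∂μ
      = 1 + p * (Real.exp s - 1) := by
    rw [integral_add (integrable_const _) ((integrable_const _).indicator hS),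
      integral_indicator hS]
    simp [p]
  simp_rw [h_eq]
  rw [integral_const_mul, h_int]
  have h_lin : 1 + p * (Real.exp s - 1) ≤ Real.exp (p * (Real.exp s - 1)) := by
    linarith [Real.add_one_le_exp (p * (Real.exp s - 1))]
  have h_quad : Real.exp s - 1 - s ≤ s ^ 2 :=
    (le_abs_self _).trans (Real.abs_exp_sub_one_sub_id_le hs)
  calc Real.exp (-(s * p)) * (1 + p * (Real.exp s - 1))
      ≤ Real.exp (-(s * p)) * Real.exp (p * (Real.exp s - 1)) := by gcongr
    _ = Real.exp (p * (Real.exp s - 1 - s)) := by rw [← Real.exp_add]; congr 1; ring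
    _ ≤ Real.exp (p * s ^ 2) := by gcongr

/-- One-sided Chernoff bound for the number of samples indexed by `T` that fall in `S`; the sign of
`s` selects the tail. -/
theorem measure_pi_le_exp {ι Ω : Type*} [Fintype ι] [MeasurableSpace Ω] (μ : Measure Ω)
    [IsProbabilityMeasure μ] {S : Set Ω} (hS : MeasurableSet S) (T : Finset ι) {s : ℝ}
    (hs : |s| ≤ 1) (a : ℝ) :
    Measure.pi (fun _ : ι => μ)
      {x | a ≤ s * ((T.filter fun t => x t ∈ S).card - T.card * μ.real S)} ≤
      ENNReal.ofReal (Real.exp (-a + T.card * μ.real S * s ^ 2)) := by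
  set p := μ.real S
  let g : ι → Ω → ℝ := fun t u => if t ∈ T then Real.exp (s * (S.indicator 1 u - p)) else 1
  have h_prod : ∀ x : ι → Ω, ∏ t, g t (x t) =
      Real.exp (s * ((T.filter fun t => x t ∈ S).card - T.card * p)) := by
    intro x
    simp only [g]
    rw [Finset.prod_ite_mem, Finset.univ_inter, ← Real.exp_sum, ← Finset.mul_sum,
      Finset.sum_sub_distrib, Finset.card_filter]
    simp [Set.indicator_apply]
  have hg_meas : ∀ t, Measurable (g t) := by
    intro t
    by_cases ht : t ∈ T
    · have : Measurable (S.indicator (1 : Ω → ℝ)) := measurable_one.indicator hS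
      simp only [g, ht, if_true]
      fun_prop
    · simp only [g, ht, if_false]
      fun_prop
  have hg_nonneg : ∀ t u, 0 ≤ g t u := by
    intro t u
    simp only [g]
    split_ifs <;> positivity
  have hg_bound : ∀ t u, g t u ≤ Real.exp (|s| * (1 + |p|)) := by
    intro t u
    simp only [g]
    split_ifs
    · refine Real.exp_le_exp.mpr ((le_abs_self _).trans ?_)
      rw [abs_mul]
      gcongr
      refine (abs_sub _ _).trans ?_
      gcongr
      by_cases hu : u ∈ S <;> simp [hu]
    · exact Real.one_le_exp (by positivity)
  have hg_int : ∀ t, Integrable (g t) μ := fun t =>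
    Integrable.of_bound (hg_meas t).aestronglyMeasurable _
      (Filter.Eventually.of_forall fun u => by
        rw [Real.norm_of_nonneg (hg_nonneg t u)]
        exact hg_bound t u)
  have h_integral : ∫ x, ∏ t, g t (x t) ∂Measure.pi (fun _ : ι => μ) ≤
      Real.exp (T.card * p * s ^ 2) := by
    rw [integral_fintype_prod_eq_prod]
    calc ∏ t, ∫ u, g t u ∂μ ≤ ∏ t, (if t ∈ T then Real.exp (p * s ^ 2) else 1) := by
          refine Finset.prod_le_prod (fun t _ => integral_nonneg (hg_nonneg t)) fun t _ => ?_
          by_cases ht : t ∈ T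
          · simpa [g, ht] using integral_exp_indicator_sub_le μ hS hs
          · simp [g, ht]
      _ = Real.exp (T.card * p * s ^ 2) := by
          rw [Finset.prod_ite_mem, Finset.univ_inter, Finset.prod_const, ← Real.exp_nat_mul]
          congr 1
          ring
  have h_markov := mul_meas_ge_le_integral_of_nonneg
    (μ := Measure.pi (fun _ : ι => μ)) (f := fun x => ∏ t, g t (x t))
    (Filter.Eventually.of_forall fun x => Finset.prod_nonneg fun t _ => hg_nonneg t (x t))
    (Integrable.fintype_prod hg_int) (Real.exp a)
  simp_rw [h_prod, Real.exp_le_exp] at h_markov h_integral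
  rw [← ENNReal.ofReal_toReal (measure_ne_top (Measure.pi fun _ : ι => μ) _)]
  refine ENNReal.ofReal_le_ofReal ?_
  rw [Real.exp_add, Real.exp_neg, inv_mul_eq_div, le_div_iff₀' (Real.exp_pos a)]
  exact h_markov.trans h_integral

theorem measure_pi_abs_sub_le_exp {ι Ω : Type*} [Fintype ι] [MeasurableSpace Ω] (μ : Measure Ω)
    [IsProbabilityMeasure μ] {S : Set Ω} (hS : MeasurableSet S) (T : Finset ι) {s : ℝ}
    (hs₀ : 0 ≤ s) (hs : s ≤ 1) (r : ℝ) :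
    Measure.pi (fun _ : ι => μ)
      {x | r ≤ |((T.filter fun t => x t ∈ S).card : ℝ) - T.card * μ.real S|} ≤
      ENNReal.ofReal (2 * Real.exp (-(s * r) + T.card * μ.real S * s ^ 2)) := by
  have h_upper := measure_pi_le_exp μ hS T (s := s) (by rwa [abs_of_nonneg hs₀]) (s * r)
  have h_lower := measure_pi_le_exp μ hS T (s := -s)
    (by rwa [abs_neg, abs_of_nonneg hs₀]) (s * r)
  rw [neg_sq] at h_lower
  rw [two_mul, ENNReal.ofReal_add (by positivity) (by positivity)]
  refine (measure_mono ?_).trans ((measure_union_le _ _).trans (add_le_add h_upper h_lower))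
  intro x hx
  rcases le_abs.mp (Set.mem_ofPred_eq ▸ hx) with h | h
  · exact Or.inl (mul_le_mul_of_nonneg_left h hs₀)
  · refine Or.inr ?_
    have := mul_le_mul_of_nonneg_left h hs₀
    simp only [Set.mem_ofPred_eq]
    linarith

instance : IsProbabilityMeasure ((volume : Measure ℝ).restrict (Set.Icc 0 1)) :=
  ⟨by simp⟩

instance (n : ℕ) : IsProbabilityMeasure (uniformCube n) := by
  unfold uniformCube
  infer_instance

theorem lastHits_eq_filter {n : ℕ} (x : Fin n → ℝ) (i : ℕ) (a b : ℝ) :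
    lastHits x i a b = (Finset.univ.filter fun t : Fin n => n - i ≤ (t : ℕ)).filter
      fun t => x t ∈ Set.Icc a b := by
  rw [Finset.filter_filter, lastHits]

theorem card_filter_sub_le_fin {n i : ℕ} (hi : i ≤ n) :
    (Finset.univ.filter fun t : Fin n => n - i ≤ (t : ℕ)).card = i := by
  have h := Fin.card_filter_val_lt (n := n) (m := n - i)
  have h_add := Finset.card_filter_add_card_filter_not (s := (Finset.univ : Finset (Fin n)))
    (fun t : Fin n => (t : ℕ) < n - i)
  simp only [not_lt, Finset.card_univ, Fintype.card_fin] at h_add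
  omega

theorem uniform_real_segment {m j : ℕ} (hj : 1 ≤ j) (hjm : j ≤ m) :
    ((volume : Measure ℝ).restrict (Set.Icc 0 1)).real
      (Set.Icc (((j : ℝ) - 1) / m) ((j : ℝ) / m)) = 1 / m := by
  have hm : (0 : ℝ) < m := by exact_mod_cast hj.trans hjm
  have hj' : (1 : ℝ) ≤ j := by exact_mod_cast hj
  have hjm' : (j : ℝ) ≤ m := by exact_mod_cast hjm
  have h_sub : Set.Icc (((j : ℝ) - 1) / m) ((j : ℝ) / m) ⊆ Set.Icc 0 1 :=
    Set.Icc_subset_Icc (div_nonneg (by linarith) hm.le) ((div_le_one hm).mpr hjm')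
  rw [measureReal_restrict_apply measurableSet_Icc, Set.inter_eq_left.mpr h_sub,
    Real.volume_real_Icc_of_le (by gcongr; linarith)]
  ring

theorem sq_div_four_le_dFn {z : ℝ} (hz : 2 ≤ z) : z ^ 2 / 4 ≤ dFn (z ^ 3) := by
  have h_rpow : (z ^ 3 : ℝ) ^ ((2 : ℝ) / 3) = z ^ 2 := by
    rw [← Real.rpow_natCast, ← Real.rpow_mul (by linarith), ← Real.rpow_natCast]
    norm_num
  rw [dFn, h_rpow]
  have := Int.ceil_lt_add_one (z ^ 3 - 1 / 2 * z ^ 2)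
  nlinarith

theorem uniformCube_segment_le {n m i j : ℕ} {z : ℝ} (hj : 1 ≤ j) (hjm : j ≤ m) (hi : i ≤ n)
    (hz : 2 ≤ z) (hzi : z ^ 3 = i / m) :
    uniformCube n {x | ¬ |((lastHits x i (((j : ℝ) - 1) / m) ((j : ℝ) / m)).card : ℝ) - i / m|
      ≤ 1 / 20 * dFn (i / m)} ≤ ENNReal.ofReal (2 * Real.exp (-(z / 25600))) := by
  have hz_pos : 0 < z := by linarith
  have h_tail := measure_pi_abs_sub_le_exp ((volume : Measure ℝ).restrict (Set.Icc 0 1))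
    (measurableSet_Icc (a := ((j : ℝ) - 1) / m) (b := (j : ℝ) / m))
    (Finset.univ.filter fun t : Fin n => n - i ≤ (t : ℕ)) (s := 1 / (160 * z)) (by positivity)
    (by rw [div_le_one (by positivity)]; linarith) (z ^ 2 / 80)
  rw [uniform_real_segment hj hjm, card_filter_sub_le_fin hi, mul_one_div, ← hzi] at h_tail
  have h_exp : -(1 / (160 * z) * (z ^ 2 / 80)) + z ^ 3 * (1 / (160 * z)) ^ 2 = -(z / 25600) := by
    field_simp
    ring
  rw [h_exp] at h_tail
  refine (measure_mono fun x hx => ?_).trans h_tail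
  simp only [Set.mem_ofPred_eq, not_le, lastHits_eq_filter, ← hzi] at hx ⊢
  have h_dev : z ^ 2 / 80 ≤ 1 / 20 * dFn (z ^ 3) := by linarith [sq_div_four_le_dFn hz]
  refine h_dev.trans (hx.le.trans_eq ?_)
  congr!

theorem pow_le_of_le_log_div_log {K n ℓ : ℕ} (hK : 2 ≤ K) (hn : 1 ≤ n)
    (hℓ : (ℓ : ℝ) ≤ Real.log n / Real.log K) : K ^ ℓ ≤ n := by
  have hlog : 0 < Real.log K := Real.log_pos (by exact_mod_cast hK)
  rw [le_div_iff₀ hlog, ← Real.log_pow, Real.log_le_log_iff (by positivity) (by positivity)] at hℓ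
  exact_mod_cast hℓ

theorem two_le_Kparam {n : ℕ} (hn : 2 ≤ Real.log n) : 2 ≤ Kparam n := by
  have h : (2 : ℝ) ≤ Real.log n ^ 8 := by nlinarith [pow_le_pow_left₀ (by norm_num) hn 8]
  exact_mod_cast h.trans (Nat.le_ceil _)

theorem uniformCube_segment_le_inv_pow {n m i j : ℕ} (hn : (358400 : ℝ) ^ 3 ≤ Real.log n)
    (hj : 1 ≤ j) (hjm : j ≤ m) (hi : i ≤ n) (hmi : (m : ℝ) * Real.log n ^ 4 ≤ i) :
    uniformCube n {x | ¬ |((lastHits x i (((j : ℝ) - 1) / m) ((j : ℝ) / m)).card : ℝ) - i / m|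
      ≤ 1 / 20 * dFn (i / m)} ≤ ENNReal.ofReal (2 / (n : ℝ) ^ 14) := by
  set L := Real.log n with hL
  have hm : (0 : ℝ) < m := by exact_mod_cast hj.trans hjm
  have hn_pos : (0 : ℝ) < n := by
    rcases Nat.eq_zero_or_pos n with rfl | h
    · norm_num [L] at hn
    · exact_mod_cast h
  have hy : L ^ 4 ≤ (i : ℝ) / m := by rwa [le_div_iff₀' hm]
  set z : ℝ := ((i : ℝ) / m) ^ ((1 : ℝ) / 3)
  have hz_nonneg : 0 ≤ z := by positivity
  have hz_cube : z ^ 3 = i / m := by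
    rw [← Real.rpow_natCast, ← Real.rpow_mul (by positivity)]
    norm_num
  have hz : 358400 * L ≤ z := by
    refine le_of_pow_le_pow_left₀ (n := 3) (by norm_num) hz_nonneg ?_
    have hL_pos : 0 ≤ L := le_trans (by norm_num) hn
    calc (358400 * L) ^ 3 = 358400 ^ 3 * L ^ 3 := by ring
      _ ≤ L * L ^ 3 := by gcongr
      _ = L ^ 4 := by ring
      _ ≤ z ^ 3 := hz_cube ▸ hy
  refine (uniformCube_segment_le hj hjm hi (by norm_num at hn; linarith) hz_cube).trans
    (ENNReal.ofReal_le_ofReal ?_)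
  rw [div_eq_mul_inv 2]
  gcongr
  calc Real.exp (-(z / 25600)) ≤ Real.exp (-((14 : ℕ) * L)) := by
        gcongr
        push_cast
        linarith
    _ = ((n : ℝ) ^ 14)⁻¹ := by rw [Real.exp_neg, Real.exp_nat_mul, hL, Real.exp_log hn_pos]

/-- With probability `1 - O(1/n^10)`: for every scale `ℓ ≤ ⌊log n / log K⌋`, every
segment `S = [(j-1)/K^ℓ, j/K^ℓ]`, and every `i` with `K^ℓ·(log n)^4 ≤ i ≤ n`, the
number of items among the last `i` that lie in `S` is `i/K^ℓ ± (1/20)·d(i/K^ℓ)`. -/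
theorem segment_counts_concentration :
    ∃ C : ℝ, 0 < C ∧ ∀ n : ℕ, 2 ≤ n →
      ENNReal.ofReal (1 - C / (n : ℝ) ^ 10) ≤
        uniformCube n
          {x | ∀ ℓ : ℕ, (ℓ : ℝ) ≤ Real.log n / Real.log (Kparam n) →
            ∀ j : ℕ, 1 ≤ j → j ≤ Kparam n ^ ℓ →
            ∀ i : ℕ, ((Kparam n : ℝ)) ^ ℓ * (Real.log n) ^ 4 ≤ (i : ℝ) → i ≤ n →
              |((lastHits x i (((j : ℝ) - 1) / (Kparam n : ℝ) ^ ℓ)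
                    ((j : ℝ) / (Kparam n : ℝ) ^ ℓ)).card : ℝ)
                  - (i : ℝ) / (Kparam n : ℝ) ^ ℓ|
                ≤ (1/20) * dFn ((i : ℝ) / (Kparam n : ℝ) ^ ℓ)} := by
  refine ⟨Real.exp (358400 ^ 3) ^ 10 + 16, by positivity, fun n hn => ?_⟩
  have hn_pos : (0 : ℝ) < n := by positivity
  rcases le_or_gt (n : ℝ) (Real.exp (358400 ^ 3)) with h_small | h_large
  · have h_one : 1 ≤ (Real.exp (358400 ^ 3) ^ 10 + 16) / (n : ℝ) ^ 10 := by
      rw [one_le_div (by positivity)]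
      linarith [pow_le_pow_left₀ hn_pos.le h_small 10]
    rw [ENNReal.ofReal_of_nonpos (by linarith)]
    exact zero_le
  have h_log : (358400 : ℝ) ^ 3 ≤ Real.log n := ((Real.lt_log_iff_exp_lt hn_pos).mpr h_large).le
  have hK : 2 ≤ Kparam n := two_le_Kparam (by norm_num at h_log; linarith)
  set A : Set (Fin n → ℝ) := {x | _} with hA
  let I := Finset.range (n + 1) ×ˢ Finset.range (n + 1) ×ˢ Finset.range (n + 1)
  let J := I.filter fun q => 1 ≤ q.2.1 ∧ q.2.1 ≤ Kparam n ^ q.1 ∧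
    ((Kparam n : ℝ)) ^ q.1 * (Real.log n) ^ 4 ≤ (q.2.2 : ℝ)
  let B : ℕ × ℕ × ℕ → Set (Fin n → ℝ) := fun q =>
    {x | ¬ |((lastHits x q.2.2 (((q.2.1 : ℝ) - 1) / (Kparam n ^ q.1 : ℕ))
      ((q.2.1 : ℝ) / (Kparam n ^ q.1 : ℕ))).card : ℝ) - q.2.2 / (Kparam n ^ q.1 : ℕ)|
        ≤ 1 / 20 * dFn (q.2.2 / (Kparam n ^ q.1 : ℕ))}
  have h_cover : Aᶜ ⊆ ⋃ q ∈ J, B q := by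
    intro x hx
    simp only [hA, Set.mem_compl_iff, Set.mem_ofPred_eq, not_forall] at hx
    obtain ⟨ℓ, hℓ, j, hj, hjK, i, hi, hin, hx⟩ := hx
    have hKn := pow_le_of_le_log_div_log hK (by omega) hℓ
    have hℓn : ℓ < n := (Nat.lt_pow_self (by omega)).trans_le hKn
    simp only [Set.mem_iUnion]
    refine ⟨(ℓ, j, i), ?_, ?_⟩
    · simp only [J, I, Finset.mem_filter, Finset.mem_product, Finset.mem_range]
      exact ⟨⟨by omega, by omega, by omega⟩, hj, hjK, hi⟩
    · simpa only [B, Nat.cast_pow, Set.mem_ofPred_eq] using hx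
  have h_each : ∀ q ∈ J, uniformCube n (B q) ≤ ENNReal.ofReal (2 / (n : ℝ) ^ 14) := by
    rintro ⟨ℓ, j, i⟩ hq
    simp only [J, I, Finset.mem_filter, Finset.mem_product, Finset.mem_range] at hq
    obtain ⟨⟨-, -, hi⟩, hj, hjK, hKi⟩ := hq
    exact uniformCube_segment_le_inv_pow h_log hj hjK (Nat.lt_succ_iff.mp hi) (by simpa using hKi)
  have h_card : (J.card : ℝ) ≤ 8 * (n : ℝ) ^ 3 := by
    have h_le : J.card ≤ (n + 1) * ((n + 1) * (n + 1)) := by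
      simpa [I, Finset.card_product] using Finset.card_filter_le I _
    have h_two : (n : ℝ) + 1 ≤ 2 * n := by
      have : (2 : ℝ) ≤ n := by exact_mod_cast hn
      linarith
    calc (J.card : ℝ) ≤ ((n : ℝ) + 1) ^ 3 := by
          rw [pow_three]
          exact_mod_cast h_le
      _ ≤ (2 * n) ^ 3 := by gcongr
      _ = 8 * (n : ℝ) ^ 3 := by ring
  have h_compl : uniformCube n Aᶜ ≤
      ENNReal.ofReal ((Real.exp (358400 ^ 3) ^ 10 + 16) / (n : ℝ) ^ 10) := by
    calc uniformCube n Aᶜ ≤ ∑ q ∈ J, uniformCube n (B q) :=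
          (measure_mono h_cover).trans (measure_biUnion_finset_le _ _)
      _ ≤ ∑ _q ∈ J, ENNReal.ofReal (2 / (n : ℝ) ^ 14) := Finset.sum_le_sum h_each
      _ = ENNReal.ofReal (J.card * (2 / (n : ℝ) ^ 14)) := by
          rw [Finset.sum_const, nsmul_eq_mul, ENNReal.ofReal_mul (by positivity),
            ENNReal.ofReal_natCast]
      _ ≤ _ := by
          refine ENNReal.ofReal_le_ofReal ?_
          have h_one : (1 : ℝ) ≤ n := by exact_mod_cast (by omega : 1 ≤ n)
          calc (J.card : ℝ) * (2 / (n : ℝ) ^ 14) ≤ 8 * (n : ℝ) ^ 3 * (2 / (n : ℝ) ^ 14) := by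
                gcongr
            _ = 16 / (n : ℝ) ^ 11 := by field_simp; norm_num
            _ ≤ 16 / (n : ℝ) ^ 10 := by gcongr; norm_num
            _ ≤ _ := by gcongr; exact le_add_of_nonneg_left (by positivity)
  rw [ENNReal.ofReal_sub _ (by positivity), ENNReal.ofReal_one, tsub_le_iff_right]
  calc (1 : ENNReal) = uniformCube n (A ∪ Aᶜ) := by rw [Set.union_compl_self, measure_univ]
    _ ≤ uniformCube n A + uniformCube n Aᶜ := measure_union_le _ _
    _ ≤ _ := by gcongr
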